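/- arXiv:2604.23735 — 3 statements merged into one kernel-verified Lean document; each statement's English description precedes it below -/
import Mathlib

section
/- Fix an integer n ≥ 2, constants μ > 0, ν > 0, ε > 0, and ξ ∈ ℝⁿ. Let A(ξ) be the (2n)×(2n) complex block matrix A(ξ) = [[−μ|ξ|²·Iₙ, i(ξ₁/ε)·Iₙ], [i(ξ₁/ε)·Iₙ, −ν|ξ|²·Iₙ]], and let B(ξ,t) := [[b₁₁(ξ,t)·Iₙ, b₁₂(ξ,t)·Iₙ], [b₂₁(ξ,t)·Iₙ, b₂₂(ξ,t)·Iₙ]]. Then for every U⁰ ∈ ℂ^{2n}, the function U(t) := B(ξ,t)·U⁰ satisfies U(0) = U⁰ and is differentiable on ℝ with U'(t) = A(ξ)·U(t) for every t ∈ ℝ. -/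
open MeasureTheory Filter

/-- `ψ(s) = sinh(s)/s` for `s ≠ 0`, `ψ(0) = 1`. -/
noncomputable def psiC (s : ℂ) : ℂ := if s = 0 then 1 else Complex.sinh s / s

/-- `δ(ξ) = ((μ−ν)|ξ|²)² − 4(ξ₁/ε)²`, where `xi1 = ξ₁` and `r = |ξ|`. -/
noncomputable def deltaMHD (mu nu eps xi1 r : ℝ) : ℝ :=
  ((mu - nu) * r ^ 2) ^ 2 - 4 * (xi1 / eps) ^ 2

/-- `Λ̃(ξ) = √δ` if `δ ≥ 0`, `Λ̃(ξ) = i√(−δ)` if `δ < 0`. -/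
noncomputable def LamTilde (mu nu eps xi1 r : ℝ) : ℂ :=
  if 0 ≤ deltaMHD mu nu eps xi1 r then (Real.sqrt (deltaMHD mu nu eps xi1 r) : ℂ)
  else Complex.I * (Real.sqrt (-deltaMHD mu nu eps xi1 r) : ℂ)

/-- `b₁₁(ξ,t) = e^{−(μ+ν)t|ξ|²/2}(cosh(Λ/2) − ((μ−ν)t|ξ|²/2)ψ(Λ/2))` with `Λ = tΛ̃`. -/
noncomputable def bMHD11 (mu nu eps xi1 r t : ℝ) : ℂ :=
  Complex.exp ((-(mu + nu) * t * r ^ 2 / 2 : ℝ) : ℂ) *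
    (Complex.cosh ((t : ℂ) * LamTilde mu nu eps xi1 r / 2)
      - (((mu - nu) * t * r ^ 2 / 2 : ℝ) : ℂ) * psiC ((t : ℂ) * LamTilde mu nu eps xi1 r / 2))

/-- `b₁₂(ξ,t) = b₂₁(ξ,t) = i(ξ₁/ε)t·e^{−(μ+ν)t|ξ|²/2}·ψ(Λ/2)` with `Λ = tΛ̃`. -/
noncomputable def bMHD12 (mu nu eps xi1 r t : ℝ) : ℂ :=
  Complex.I * ((xi1 / eps * t : ℝ) : ℂ) * Complex.exp ((-(mu + nu) * t * r ^ 2 / 2 : ℝ) : ℂ) *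
    psiC ((t : ℂ) * LamTilde mu nu eps xi1 r / 2)

/-- `b₂₂(ξ,t) = e^{−(μ+ν)t|ξ|²/2}(cosh(Λ/2) + ((μ−ν)t|ξ|²/2)ψ(Λ/2))` with `Λ = tΛ̃`. -/
noncomputable def bMHD22 (mu nu eps xi1 r t : ℝ) : ℂ :=
  Complex.exp ((-(mu + nu) * t * r ^ 2 / 2 : ℝ) : ℂ) *
    (Complex.cosh ((t : ℂ) * LamTilde mu nu eps xi1 r / 2)
      + (((mu - nu) * t * r ^ 2 / 2 : ℝ) : ℂ) * psiC ((t : ℂ) * LamTilde mu nu eps xi1 r / 2))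

theorem LamTilde_sq (mu nu eps xi1 r : ℝ) :
    LamTilde mu nu eps xi1 r ^ 2 = (deltaMHD mu nu eps xi1 r : ℂ) := by
  unfold LamTilde
  split_ifs with h
  · rw [← Complex.ofReal_pow, Real.sq_sqrt h]
  · rw [mul_pow, Complex.I_sq, ← Complex.ofReal_pow, Real.sq_sqrt (by linarith)]
    push_cast
    ring

theorem hasDerivAt_cosh_mul_half (L : ℂ) (t : ℝ) :
    HasDerivAt (fun x : ℝ => Complex.cosh ((x : ℂ) * L / 2))
      (L ^ 2 / 4 * ((t : ℂ) * psiC ((t : ℂ) * L / 2))) t := by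
  have h1 : HasDerivAt (fun z : ℂ => z * L / 2) (1 * L / 2) (t : ℂ) :=
    ((hasDerivAt_id (t : ℂ)).mul_const L).div_const 2
  refine h1.ccosh.comp_ofReal.congr_deriv ?_
  unfold psiC
  split_ifs with h
  · rw [h, Complex.sinh_zero]
    linear_combination (-L / 2) * h
  · have hL : L ≠ 0 := by rintro rfl; simp at h
    have ht : (t : ℂ) ≠ 0 := by intro ht; simp [ht] at h
    field_simp
    ring

theorem hasDerivAt_mul_psiC (L : ℂ) (t : ℝ) :
    HasDerivAt (fun x : ℝ => (x : ℂ) * psiC ((x : ℂ) * L / 2))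
      (Complex.cosh ((t : ℂ) * L / 2)) t := by
  by_cases hL : L = 0
  · subst hL
    simpa [psiC] using (hasDerivAt_id (t : ℂ)).comp_ofReal
  · have h1 : HasDerivAt (fun z : ℂ => z * L / 2) (1 * L / 2) (t : ℂ) :=
      ((hasDerivAt_id (t : ℂ)).mul_const L).div_const 2
    refine ((h1.csinh.mul_const (2 / L)).comp_ofReal.congr_deriv ?_).congr_of_eventuallyEq
      (.of_forall fun x => ?_)
    · field_simp
    · simp only
      unfold psiC
      split_ifs with h
      · have hx : (x : ℂ) = 0 := by simpa [hL] using h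
        simp [hx]
      · have hx : (x : ℂ) ≠ 0 := by intro hx; simp [hx] at h
        field_simp

theorem hasDerivAt_exp_decay (mu nu r t : ℝ) :
    HasDerivAt (fun x : ℝ => Complex.exp ((-(mu + nu) * x * r ^ 2 / 2 : ℝ) : ℂ))
      (-((mu : ℂ) + nu) * (r : ℂ) ^ 2 / 2 *
        Complex.exp ((-(mu + nu) * t * r ^ 2 / 2 : ℝ) : ℂ)) t := by
  have h : HasDerivAt (fun x : ℝ => -(mu + nu) * x * r ^ 2 / 2)
      (-(mu + nu) * 1 * r ^ 2 / 2) t :=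
    ((((hasDerivAt_id t).const_mul (-(mu + nu))).mul_const (r ^ 2)).div_const 2)
  refine h.ofReal_comp.cexp.congr_deriv ?_
  push_cast
  ring

theorem hasDerivAt_bMHD11 (mu nu eps xi1 r t : ℝ) :
    HasDerivAt (bMHD11 mu nu eps xi1 r)
      (((-(mu * r ^ 2) : ℝ) : ℂ) * bMHD11 mu nu eps xi1 r t
        + Complex.I * ((xi1 / eps : ℝ) : ℂ) * bMHD12 mu nu eps xi1 r t) t := by
  have h := (hasDerivAt_exp_decay mu nu r t).mul
    ((hasDerivAt_cosh_mul_half (LamTilde mu nu eps xi1 r) t).sub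
      ((hasDerivAt_mul_psiC (LamTilde mu nu eps xi1 r) t).const_mul
        (((mu - nu) * r ^ 2 / 2 : ℝ) : ℂ)))
  refine (h.congr_deriv ?_).congr_of_eventuallyEq (.of_forall fun x => ?_)
  · simp only [bMHD11, bMHD12, LamTilde_sq, deltaMHD, Pi.sub_apply]
    push_cast
    ring_nf
    simp only [Complex.I_sq]
    ring
  · simp only [bMHD11, Pi.mul_apply, Pi.sub_apply]
    push_cast
    ring

theorem hasDerivAt_bMHD22 (mu nu eps xi1 r t : ℝ) :
    HasDerivAt (bMHD22 mu nu eps xi1 r)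
      (Complex.I * ((xi1 / eps : ℝ) : ℂ) * bMHD12 mu nu eps xi1 r t
        + ((-(nu * r ^ 2) : ℝ) : ℂ) * bMHD22 mu nu eps xi1 r t) t := by
  have h := (hasDerivAt_exp_decay mu nu r t).mul
    ((hasDerivAt_cosh_mul_half (LamTilde mu nu eps xi1 r) t).add
      ((hasDerivAt_mul_psiC (LamTilde mu nu eps xi1 r) t).const_mul
        (((mu - nu) * r ^ 2 / 2 : ℝ) : ℂ)))
  refine (h.congr_deriv ?_).congr_of_eventuallyEq (.of_forall fun x => ?_)
  · simp only [bMHD22, bMHD12, LamTilde_sq, deltaMHD, Pi.add_apply]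
    push_cast
    ring_nf
    simp only [Complex.I_sq]
    ring
  · simp only [bMHD22, Pi.mul_apply, Pi.add_apply]
    push_cast
    ring

theorem hasDerivAt_bMHD12 (mu nu eps xi1 r t : ℝ) :
    HasDerivAt (bMHD12 mu nu eps xi1 r)
      (-(((mu : ℂ) + nu) * (r : ℂ) ^ 2 / 2) * bMHD12 mu nu eps xi1 r t
        + Complex.I * ((xi1 / eps : ℝ) : ℂ) *
          (Complex.exp ((-(mu + nu) * t * r ^ 2 / 2 : ℝ) : ℂ) *
            Complex.cosh ((t : ℂ) * LamTilde mu nu eps xi1 r / 2))) t := by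
  have h := ((hasDerivAt_exp_decay mu nu r t).mul
    (hasDerivAt_mul_psiC (LamTilde mu nu eps xi1 r) t)).const_mul
      (Complex.I * ((xi1 / eps : ℝ) : ℂ))
  refine (h.congr_deriv ?_).congr_of_eventuallyEq (.of_forall fun x => ?_)
  · simp only [bMHD12]
    push_cast
    ring
  · simp only [bMHD12, Pi.mul_apply]
    push_cast
    ring

theorem hasDerivAt_bMHD12_eq_first_row (mu nu eps xi1 r t : ℝ) :
    HasDerivAt (bMHD12 mu nu eps xi1 r)
      (((-(mu * r ^ 2) : ℝ) : ℂ) * bMHD12 mu nu eps xi1 r t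
        + Complex.I * ((xi1 / eps : ℝ) : ℂ) * bMHD22 mu nu eps xi1 r t) t := by
  refine (hasDerivAt_bMHD12 mu nu eps xi1 r t).congr_deriv ?_
  simp only [bMHD12, bMHD22]
  push_cast
  ring

theorem hasDerivAt_bMHD12_eq_second_row (mu nu eps xi1 r t : ℝ) :
    HasDerivAt (bMHD12 mu nu eps xi1 r)
      (Complex.I * ((xi1 / eps : ℝ) : ℂ) * bMHD11 mu nu eps xi1 r t
        + ((-(nu * r ^ 2) : ℝ) : ℂ) * bMHD12 mu nu eps xi1 r t) t := by
  refine (hasDerivAt_bMHD12 mu nu eps xi1 r t).congr_deriv ?_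
  simp only [bMHD12, bMHD11]
  push_cast
  ring

theorem fromBlocks_smul_one_mulVec {n : ℕ} (a b c d : ℂ) (v : Fin n ⊕ Fin n → ℂ) :
    (Matrix.fromBlocks (a • (1 : Matrix (Fin n) (Fin n) ℂ)) (b • (1 : Matrix (Fin n) (Fin n) ℂ))
      (c • (1 : Matrix (Fin n) (Fin n) ℂ)) (d • (1 : Matrix (Fin n) (Fin n) ℂ))).mulVec v =
    Sum.elim (fun j => a * v (Sum.inl j) + b * v (Sum.inr j))
      (fun j => c * v (Sum.inl j) + d * v (Sum.inr j)) := by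
  rw [Matrix.fromBlocks_mulVec]
  simp only [Matrix.smul_mulVec, Matrix.one_mulVec]
  rfl

/-- Solution formula (26021113041) of Lemma 5.1: for fixed frequency `ξ`, the function
`U(t) = B(ξ,t)·U⁰` solves the linearized MHD ODE `U' = A(ξ)·U`, `U(0) = U⁰`, where
`A(ξ) = [[−μ|ξ|²·I, i(ξ₁/ε)·I], [i(ξ₁/ε)·I, −ν|ξ|²·I]]` and `B(ξ,t)` is the block
matrix with entries `b₁₁, b₁₂, b₂₁ = b₁₂, b₂₂`. -/
theorem stmt_6 (n : ℕ) (hn : 2 ≤ n) (mu nu eps : ℝ)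
    (hmu : 0 < mu) (hnu : 0 < nu) (heps : 0 < eps)
    (ξ : EuclideanSpace ℝ (Fin n)) :
    letI xi1 : ℝ := ξ ⟨0, by omega⟩
    letI A : Matrix (Fin n ⊕ Fin n) (Fin n ⊕ Fin n) ℂ :=
      Matrix.fromBlocks
        (((-(mu * ‖ξ‖ ^ 2) : ℝ) : ℂ) • (1 : Matrix (Fin n) (Fin n) ℂ))
        ((Complex.I * ((xi1 / eps : ℝ) : ℂ)) • (1 : Matrix (Fin n) (Fin n) ℂ))
        ((Complex.I * ((xi1 / eps : ℝ) : ℂ)) • (1 : Matrix (Fin n) (Fin n) ℂ))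
        (((-(nu * ‖ξ‖ ^ 2) : ℝ) : ℂ) • (1 : Matrix (Fin n) (Fin n) ℂ))
    letI B : ℝ → Matrix (Fin n ⊕ Fin n) (Fin n ⊕ Fin n) ℂ := fun t =>
      Matrix.fromBlocks
        (bMHD11 mu nu eps xi1 ‖ξ‖ t • (1 : Matrix (Fin n) (Fin n) ℂ))
        (bMHD12 mu nu eps xi1 ‖ξ‖ t • (1 : Matrix (Fin n) (Fin n) ℂ))
        (bMHD12 mu nu eps xi1 ‖ξ‖ t • (1 : Matrix (Fin n) (Fin n) ℂ))
        (bMHD22 mu nu eps xi1 ‖ξ‖ t • (1 : Matrix (Fin n) (Fin n) ℂ))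
    ∀ U0 : Fin n ⊕ Fin n → ℂ,
      letI U : ℝ → (Fin n ⊕ Fin n → ℂ) := fun t => (B t).mulVec U0
      U 0 = U0 ∧ ∀ t : ℝ, HasDerivAt U (A.mulVec (U t)) t := by
  intro U0
  simp only [fromBlocks_smul_one_mulVec]
  refine ⟨?_, fun t => ?_⟩
  · funext j
    cases j <;> simp [bMHD11, bMHD12, bMHD22, psiC]
  · rw [hasDerivAt_pi]
    rintro (j | j)
    · simp only [Sum.elim_inl, Sum.elim_inr]
      refine (((hasDerivAt_bMHD11 mu nu eps (ξ ⟨0, by omega⟩) ‖ξ‖ t).mul_const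
        (U0 (Sum.inl j))).add ((hasDerivAt_bMHD12_eq_first_row mu nu eps
          (ξ ⟨0, by omega⟩) ‖ξ‖ t).mul_const (U0 (Sum.inr j)))).congr_deriv ?_
      ring
    · simp only [Sum.elim_inl, Sum.elim_inr]
      refine (((hasDerivAt_bMHD12_eq_second_row mu nu eps (ξ ⟨0, by omega⟩) ‖ξ‖ t).mul_const
        (U0 (Sum.inl j))).add ((hasDerivAt_bMHD22 mu nu eps
          (ξ ⟨0, by omega⟩) ‖ξ‖ t).mul_const (U0 (Sum.inr j)))).congr_deriv ?_
      ring
end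

section
/- Let μ > 0 and ν > 0. There exist constants c̃ ∈ (0,1), c > 0 and C > 0, depending only on μ and ν, with the following property. For every ε > 0 and every η ≥ 0, define Φ : ℝ → ℝ by Φ(s) := 4ε^{−2}s² − (μ−ν)²(s² + η²)². Then for every s ≠ 0 satisfying s² + η² ≤ c̃³·ε^{−1}|s|, one has Φ(s) ≥ 2ε^{−2}s² > 0, the function √Φ is differentiable at s, and c·ε^{−1} ≤ |(√Φ)'(s)| ≤ C·ε^{−1}. -/
/-- Estimates (26021312345) and (26021313061): with
`Φ(s) = 4ε⁻²s² − (μ−ν)²(s²+η²)²`, there exist `c̃ ∈ (0,1)` and `0 < c ≤ C` (depending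
only on `μ, ν`) such that for all `ε > 0`, `η ≥ 0` and all `s ≠ 0` with
`s² + η² ≤ c̃³ ε⁻¹|s|`, one has `Φ(s) ≥ 2ε⁻²s² > 0`, `√Φ` is differentiable at `s`,
and `c ε⁻¹ ≤ |(√Φ)'(s)| ≤ C ε⁻¹`. -/
theorem stmt_12 (mu nu : ℝ) (hmu : 0 < mu) (hnu : 0 < nu) :
    ∃ ctil ∈ Set.Ioo (0 : ℝ) 1, ∃ c > (0 : ℝ), ∃ C > (0 : ℝ),
      ∀ eps : ℝ, 0 < eps → ∀ η : ℝ, 0 ≤ η → ∀ s : ℝ, s ≠ 0 →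
        s ^ 2 + η ^ 2 ≤ ctil ^ 3 * eps⁻¹ * |s| →
          (2 * eps⁻¹ ^ 2 * s ^ 2
              ≤ 4 * eps⁻¹ ^ 2 * s ^ 2 - (mu - nu) ^ 2 * (s ^ 2 + η ^ 2) ^ 2) ∧
            0 < 2 * eps⁻¹ ^ 2 * s ^ 2 ∧
            ∃ d : ℝ,
              HasDerivAt
                (fun y : ℝ =>
                  Real.sqrt (4 * eps⁻¹ ^ 2 * y ^ 2 - (mu - nu) ^ 2 * (y ^ 2 + η ^ 2) ^ 2))
                d s ∧
              c * eps⁻¹ ≤ |d| ∧ |d| ≤ C * eps⁻¹ := by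
  set m : ℝ := (mu - nu) ^ 2 with hm
  have hm0 : 0 ≤ m := sq_nonneg _
  set k : ℝ := (2 + m)⁻¹ with hk
  have hk0 : 0 < k := by positivity
  have hkm : k * (2 + m) = 1 := inv_mul_cancel₀ (by positivity)
  have hmk0 : 0 ≤ m * k := by positivity
  have hk2 : k ≤ 1 / 2 := by nlinarith
  have hmk : m * k ≤ 1 := by nlinarith
  have hK : m * k ^ 6 ≤ 1 / 2 := by
    calc m * k ^ 6 = (m * k) * k ^ 5 := by ring
      _ ≤ 1 * (1 / 2) ^ 5 := by gcongr
      _ ≤ 1 / 2 := by norm_num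
  refine ⟨k, ⟨hk0, by linarith⟩, 1, one_pos, 4, by norm_num, ?_⟩
  intro eps heps η _ s hs h
  set e : ℝ := eps⁻¹ with he
  have he0 : 0 < e := inv_pos.mpr heps
  have hs0 : 0 < |s| := abs_pos.mpr hs
  have hss : |s| ^ 2 = s ^ 2 := sq_abs s
  set q : ℝ := s ^ 2 + η ^ 2 with hq
  have hq0 : 0 ≤ q := by positivity
  have hs_le : |s| ≤ k ^ 3 * e := by
    refine le_of_mul_le_mul_right ?_ hs0
    nlinarith [sq_nonneg η]
  have hmq : m * q ≤ e ^ 2 / 2 := by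
    calc m * q ≤ m * (k ^ 3 * e * (k ^ 3 * e)) := by
          gcongr
          exact h.trans (by gcongr)
      _ = m * k ^ 6 * e ^ 2 := by ring
      _ ≤ 1 / 2 * e ^ 2 := by gcongr
      _ = e ^ 2 / 2 := by ring
  have hmq2 : m * q ^ 2 ≤ e ^ 2 * s ^ 2 / 2 := by
    calc m * q ^ 2 ≤ m * (k ^ 3 * e * |s|) ^ 2 := by gcongr
      _ = m * k ^ 6 * (e ^ 2 * s ^ 2) := by rw [← hss]; ring
      _ ≤ 1 / 2 * (e ^ 2 * s ^ 2) := by gcongr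
      _ = e ^ 2 * s ^ 2 / 2 := by ring
  have hes : 0 < e ^ 2 * s ^ 2 := by positivity
  have hmq0 : 0 ≤ m * q := by positivity
  have hmq20 : 0 ≤ m * q ^ 2 := by positivity
  set P : ℝ := 4 * e ^ 2 * s ^ 2 - m * q ^ 2 with hP
  have hP0 : 0 < P := by linarith
  have hlow : e * |s| ≤ √P := by
    refine Real.le_sqrt_of_sq_le ?_
    rw [mul_pow, hss]
    linarith
  have hup : √P ≤ 2 * e * |s| := by
    refine Real.sqrt_le_iff.mpr ⟨by positivity, ?_⟩
    rw [mul_pow, mul_pow, hss]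
    linarith
  have hr0 : 0 < √P := Real.sqrt_pos.mpr hP0
  have hderiv : HasDerivAt
      (fun y : ℝ => 4 * e ^ 2 * y ^ 2 - m * (y ^ 2 + η ^ 2) ^ 2)
      (4 * s * (2 * e ^ 2 - m * q)) s := by
    have h1 := (hasDerivAt_pow 2 s).const_mul (4 * e ^ 2)
    have h2 := (((hasDerivAt_pow 2 s).add_const (η ^ 2)).pow 2).const_mul m
    refine (h1.sub h2).congr_deriv ?_
    rw [hq]
    push_cast
    ring
  have habs : |4 * s * (2 * e ^ 2 - m * q) / (2 * √P)|
      = 2 * |s| * (2 * e ^ 2 - m * q) / √P := by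
    rw [abs_div, abs_mul, abs_mul, abs_of_pos (show (0 : ℝ) < 4 by norm_num),
      abs_of_nonneg (show 0 ≤ 2 * e ^ 2 - m * q by nlinarith),
      abs_of_pos (show 0 < 2 * √P by positivity)]
    field_simp
    ring
  refine ⟨by linarith, by positivity, _, hderiv.sqrt hP0.ne', ?_, ?_⟩
  · refine le_of_le_of_eq ?_ habs.symm
    rw [le_div_iff₀ hr0]
    calc 1 * e * √P ≤ 1 * e * (2 * e * |s|) := by gcongr
      _ = 2 * |s| * e ^ 2 := by ring
      _ ≤ 2 * |s| * (2 * e ^ 2 - m * q) := by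
          gcongr
          nlinarith [sq_nonneg e]
  · refine le_of_eq_of_le habs ?_
    rw [div_le_iff₀ hr0]
    calc 2 * |s| * (2 * e ^ 2 - m * q) ≤ 2 * |s| * (2 * e ^ 2) := by
          gcongr
          linarith
      _ = 4 * e * (e * |s|) := by ring
      _ ≤ 4 * e * √P := by gcongr
end

section
/- Let μ > 0 and ν > 0. There exists a constant c̃ ∈ (0,1) depending only on μ and ν, and for every integer ℓ ≥ 1 a constant C_ℓ > 0 depending only on ℓ, μ and ν, with the following property. For every ε > 0 and every η ≥ 0, define Φ : ℝ → ℝ by Φ(s) := 4ε^{−2}s² − (μ−ν)²(s² + η²)². Then for every s ≠ 0 satisfying s² + η² ≤ c̃³·ε^{−1}|s|, the function √Φ is infinitely differentiable in a neighborhood of s and its ℓ-th derivative satisfies |(√Φ)^{(ℓ)}(s)| ≤ C_ℓ·ε^{−1}·|s|^{1−ℓ}. -/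
open scoped ContDiff in
/-- The iterated partial derivatives in the last variable of a function that is smooth on an open
set are smooth on that set. -/
theorem exists_contDiffOn_eq_iteratedDeriv_snd {E : Type*} [NormedAddCommGroup E]
    [NormedSpace ℝ E] {F : E × ℝ → ℝ} {U : Set (E × ℝ)} (hU : IsOpen U)
    (hF : ContDiffOn ℝ ∞ F U) (l : ℕ) :
    ∃ G : E × ℝ → ℝ, ContDiffOn ℝ ∞ G U ∧
      ∀ z ∈ U, iteratedDeriv l (fun v => F (z.1, v)) z.2 = G z := by
  induction l with
  | zero => exact ⟨F, hF, fun z _ => by simp⟩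
  | succ l ih =>
    obtain ⟨G, hG, hGF⟩ := ih
    refine ⟨fun z => fderiv ℝ G z (0, 1),
      ((contDiffOn_infty_iff_fderiv_of_isOpen hU).1 hG).2.clm_apply contDiffOn_const, ?_⟩
    rintro ⟨x, u⟩ hz
    have hnear : ∀ᶠ v in nhds u, (x, v) ∈ U :=
      (Continuous.prodMk_right x).continuousAt.eventually (hU.mem_nhds hz)
    have heq : iteratedDeriv l (fun v => F (x, v)) =ᶠ[nhds u] fun v => G (x, v) :=
      hnear.mono fun v hv => hGF (x, v) hv
    have hd : HasFDerivAt G (fderiv ℝ G (x, u)) (x, u) :=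
      ((hG.contDiffAt (hU.mem_nhds hz)).differentiableAt (by simp)).hasFDerivAt
    rw [iteratedDeriv_succ, heq.deriv_eq]
    exact (hd.comp_hasDerivAt u ((hasDerivAt_const u x).prodMk (hasDerivAt_id u))).deriv

theorem iteratedDeriv_const_mul_comp_mul_const (f : ℝ → ℝ) (c r : ℝ) (l : ℕ) (y : ℝ) :
    iteratedDeriv l (fun x => c * f (x * r)) y = c * r ^ l * iteratedDeriv l f (y * r) := by
  induction l generalizing y with
  | zero => simp
  | succ l ih =>
    have hscale := deriv_comp_mul_left r (iteratedDeriv l f) y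
    simp only [mul_comm r, smul_eq_mul] at hscale
    rw [iteratedDeriv_succ, funext ih, iteratedDeriv_succ, deriv_const_mul_field, hscale, pow_succ]
    ring

/-- The symbol `√Φ` in the rescaled variable `u = y / s`, with parameters `p = ε |s|` and
`q = ε η² / |s|`, satisfies `√Φ(y) = ε⁻¹ |s| √(4 u² - b² (p u² + q)²)`. -/
theorem sqrt_phase_eq_rescaled (b eps η s : ℝ) (heps : 0 < eps) (hs : s ≠ 0) (y : ℝ) :
    Real.sqrt (4 * eps⁻¹ ^ 2 * y ^ 2 - b ^ 2 * (y ^ 2 + η ^ 2) ^ 2) =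
      eps⁻¹ * |s| * Real.sqrt (4 * (y * s⁻¹) ^ 2 -
        b ^ 2 * (eps * |s| * (y * s⁻¹) ^ 2 + eps * η ^ 2 / |s|) ^ 2) := by
  have h0 : 0 < |s| := abs_pos.2 hs
  have h1 : 0 ≤ eps⁻¹ * |s| := by positivity
  have h2 : (y * s⁻¹) ^ 2 = y ^ 2 / |s| ^ 2 := by rw [sq_abs]; field_simp
  rw [← Real.sqrt_sq h1, ← Real.sqrt_mul (sq_nonneg _), h2]
  congr 1
  field_simp


/-- Estimate (2602131306): with `Φ(s) = 4ε⁻²s² − (μ−ν)²(s²+η²)²`, there exists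
`c̃ ∈ (0,1)` depending only on `μ, ν`, and for every `ℓ ≥ 1` a constant `C_ℓ > 0`, such
that for all `ε > 0`, `η ≥ 0` and all `s ≠ 0` with `s² + η² ≤ c̃³ ε⁻¹|s|`, the function
`√Φ` is smooth near `s` and `|(√Φ)^{(ℓ)}(s)| ≤ C_ℓ ε⁻¹ |s|^{1−ℓ}`. -/
theorem stmt_13 (mu nu : ℝ) (hmu : 0 < mu) (hnu : 0 < nu) :
    ∃ ctil ∈ Set.Ioo (0 : ℝ) 1, ∀ l : ℕ, 1 ≤ l → ∃ C > (0 : ℝ),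
      ∀ eps : ℝ, 0 < eps → ∀ η : ℝ, 0 ≤ η → ∀ s : ℝ, s ≠ 0 →
        s ^ 2 + η ^ 2 ≤ ctil ^ 3 * eps⁻¹ * |s| →
          ContDiffAt ℝ (⊤ : ℕ∞)
              (fun y : ℝ =>
                Real.sqrt (4 * eps⁻¹ ^ 2 * y ^ 2 - (mu - nu) ^ 2 * (y ^ 2 + η ^ 2) ^ 2))
              s ∧
            |iteratedDeriv l
                (fun y : ℝ =>
                  Real.sqrt (4 * eps⁻¹ ^ 2 * y ^ 2 - (mu - nu) ^ 2 * (y ^ 2 + η ^ 2) ^ 2))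
                s|
              ≤ C * eps⁻¹ * |s| ^ ((1 : ℤ) - (l : ℤ)) := by
  set b := mu - nu
  have hb : 0 ≤ |b| := abs_nonneg b
  have hc0 : 0 < (1 + |b|)⁻¹ / 2 := by positivity
  have hinv : (1 + |b|)⁻¹ ≤ 1 := inv_le_one_of_one_le₀ (by linarith)
  refine ⟨(1 + |b|)⁻¹ / 2, ⟨hc0, by linarith⟩, ?_⟩
  set c := (1 + |b|)⁻¹ / 2 with hc
  have hc1 : c < 1 := by linarith
  have hc3 : c ^ 3 ≤ c := by nlinarith [mul_pos hc0 hc0]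
  have hbc : |b| * c ≤ 1 := by
    have : (1 + |b|) * (1 + |b|)⁻¹ = 1 := mul_inv_cancel₀ (by positivity)
    rw [hc]
    nlinarith
  let P : (ℝ × ℝ) × ℝ → ℝ := fun z => 4 * z.2 ^ 2 - b ^ 2 * (z.1.1 * z.2 ^ 2 + z.1.2) ^ 2
  have hP : ContDiff ℝ (⊤ : ℕ∞) P := by fun_prop
  let U : Set ((ℝ × ℝ) × ℝ) := {z | 0 < P z}
  have hU : IsOpen U := isOpen_lt continuous_const hP.continuous
  have hF : ContDiffOn ℝ (⊤ : ℕ∞) (fun z => Real.sqrt (P z)) U :=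
    hP.contDiffOn.sqrt fun z hz => ne_of_gt hz
  let K : Set ((ℝ × ℝ) × ℝ) :=
    (Set.Icc (0 : ℝ) c ×ˢ Set.Icc (0 : ℝ) c) ×ˢ {(1 : ℝ)} ∩ {z | z.1.1 + z.1.2 ≤ c}
  have hK : IsCompact K :=
    ((isCompact_Icc.prod isCompact_Icc).prod isCompact_singleton).inter_right
      (isClosed_le (by fun_prop) continuous_const)
  have hKU : K ⊆ U := by
    rintro ⟨⟨p, q⟩, u⟩ ⟨⟨⟨hp, hq⟩, hu⟩, hpq⟩
    simp only [Set.mem_Icc, Set.mem_singleton_iff, Set.mem_ofPred_eq] at hp hq hu hpq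
    subst hu
    have h1 : |b| * (p + q) ≤ 1 := (mul_le_mul_of_nonneg_left hpq hb).trans hbc
    have h2 : 0 ≤ |b| * (p + q) := mul_nonneg hb (by linarith [hp.1, hq.1])
    have h3 : (|b| * (p + q)) ^ 2 ≤ 1 := pow_le_one₀ h2 h1
    rw [mul_pow, sq_abs] at h3
    change 0 < 4 * (1 : ℝ) ^ 2 - b ^ 2 * (p * 1 ^ 2 + q) ^ 2
    simp only [one_pow, mul_one]
    linarith
  intro l _
  obtain ⟨G, hG, hGF⟩ := exists_contDiffOn_eq_iteratedDeriv_snd hU hF l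
  obtain ⟨C, hC⟩ := hK.exists_bound_of_continuousOn (hG.continuousOn.mono hKU)
  refine ⟨max C 1, by positivity, fun eps heps η _ s hs hle => ?_⟩
  have h0 : 0 < |s| := abs_pos.2 hs
  have hmem : (((eps * |s|, eps * η ^ 2 / |s|), s * s⁻¹) : (ℝ × ℝ) × ℝ) ∈ K := by
    have h1 : eps * |s| + eps * η ^ 2 / |s| ≤ c := by
      refine le_trans ?_ hc3
      calc eps * |s| + eps * η ^ 2 / |s| = eps / |s| * (s ^ 2 + η ^ 2) := by
            rw [← sq_abs s]; field_simp
        _ ≤ eps / |s| * (c ^ 3 * eps⁻¹ * |s|) := by gcongr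
        _ = c ^ 3 := by field_simp
    have h2 : 0 ≤ eps * |s| := by positivity
    have h3 : 0 ≤ eps * η ^ 2 / |s| := by positivity
    exact ⟨⟨⟨⟨h2, by linarith⟩, h3, by linarith⟩, mul_inv_cancel₀ hs⟩, h1⟩
  have hcongr := funext (sqrt_phase_eq_rescaled b eps η s heps hs)
  rw [hcongr]
  constructor
  · have hpos : P ((eps * |s|, eps * η ^ 2 / |s|), s * s⁻¹) ≠ 0 := ne_of_gt (hKU hmem)
    exact contDiffAt_const.mul (ContDiffAt.sqrt (by fun_prop) hpos)
  · rw [iteratedDeriv_const_mul_comp_mul_const (fun u => Real.sqrt (4 * u ^ 2 -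
        b ^ 2 * (eps * |s| * u ^ 2 + eps * η ^ 2 / |s|) ^ 2))]
    have hval := hGF _ (hKU hmem)
    have hbd := hC _ hmem
    rw [← hval, Real.norm_eq_abs] at hbd
    rw [abs_mul, abs_mul, abs_mul, abs_abs, abs_pow, abs_inv, abs_inv, abs_of_pos heps,
      zpow_sub₀ h0.ne', zpow_one, zpow_natCast]
    calc _ ≤ eps⁻¹ * |s| * |s|⁻¹ ^ l * max C 1 := by
          gcongr
          exact hbd.trans (le_max_left _ _)
      _ = max C 1 * eps⁻¹ * (|s| / |s| ^ l) := by
          rw [inv_pow]; ring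
end
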